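/- arXiv:1303.4117 — 3 statements merged into one kernel-verified Lean document; each statement's English description precedes it below -/
import Mathlib

section
/- Suppose Π is an edge-decomposition of the complete graph K_r with M(Π) < (1/4)·r·(√(4r − 3) − 1). Then there exists a simple edge-decomposition Π′ of K_r with M(Π′) = M(Π). -/
open scoped BigOperators

/-- An edge-decomposition of the complete graph `K_r` (on vertex set `Fin r`)
into cliques, each of order at least `2`: every edge (unordered pair of
distinct vertices) lies in exactly one of the cliques. -/
structure CliqueDecomp (r : ℕ) where
  cliques : Finset (Finset (Fin r))
  two_le : ∀ c ∈ cliques, 2 ≤ c.card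
  covers : ∀ x y : Fin r, x ≠ y →
    ∃! c : Finset (Fin r), c ∈ cliques ∧ x ∈ c ∧ y ∈ c

/-- `M(Π) = Σᵢ ⌊rᵢ/2⌋`, summed over the clique orders `rᵢ` of the
decomposition. -/
def CliqueDecomp.M {r : ℕ} (D : CliqueDecomp r) : ℕ :=
  ∑ c ∈ D.cliques, c.card / 2

/-- A decomposition is simple if at most one of its cliques has order `> 3`. -/
def CliqueDecomp.Simple {r : ℕ} (D : CliqueDecomp r) : Prop :=
  (D.cliques.filter fun c => 3 < c.card).card ≤ 1

namespace CliqueDecomp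

variable {r : ℕ}

theorem uniq (D : CliqueDecomp r) {c c' : Finset (Fin r)} (hc : c ∈ D.cliques)
    (hc' : c' ∈ D.cliques) {x y : Fin r} (hxy : x ≠ y) (h1 : x ∈ c) (h2 : y ∈ c)
    (h3 : x ∈ c') (h4 : y ∈ c') : c = c' :=
  (D.covers x y hxy).unique ⟨hc, h1, h2⟩ ⟨hc', h3, h4⟩

theorem sum_offDiag (D : CliqueDecomp r) (A : Finset (Fin r)) :
    ∑ c ∈ D.cliques, (c ∩ A).offDiag.card = A.offDiag.card := by
  classical
  rw [← Finset.card_biUnion]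
  · congr 1
    ext ⟨x, y⟩
    simp only [Finset.mem_biUnion, Finset.mem_offDiag, Finset.mem_inter]
    constructor
    · rintro ⟨c, hc, ⟨h1, h2⟩, ⟨h3, h4⟩, h5⟩
      exact ⟨h2, h4, h5⟩
    · rintro ⟨h2, h4, h5⟩
      obtain ⟨c, ⟨hc, h1, h3⟩, -⟩ := D.covers x y h5
      exact ⟨c, hc, ⟨h1, h2⟩, ⟨h3, h4⟩, h5⟩
  · intro c hc c' hc' hne
    rw [Function.onFun, Finset.disjoint_left]
    rintro ⟨x, y⟩ h h'
    simp only [Finset.mem_offDiag, Finset.mem_inter] at h h'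
    exact hne (D.uniq hc hc' h.2.2 h.1.1 h.2.1.1 h'.1.1 h'.2.1.1)

theorem sum_deg (D : CliqueDecomp r) (v : Fin r) :
    ∑ c ∈ D.cliques with v ∈ c, (c.card - 1) = r - 1 := by
  classical
  have h1 : ∑ c ∈ D.cliques with v ∈ c, (c.card - 1)
      = ∑ c ∈ D.cliques with v ∈ c, (c.erase v).card := by
    apply Finset.sum_congr rfl
    intro c hc
    rw [Finset.card_erase_of_mem (Finset.mem_filter.1 hc).2]
  rw [h1, ← Finset.card_biUnion]
  · have : (D.cliques.filter (fun c => v ∈ c)).biUnion (fun c => c.erase v)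
        = Finset.univ.erase v := by
      ext x
      simp only [Finset.mem_biUnion, Finset.mem_filter, Finset.mem_erase, Finset.mem_univ,
        and_true]
      constructor
      · rintro ⟨c, _, h, _⟩
        exact h
      · intro h
        obtain ⟨c, ⟨hc, h1, h3⟩, -⟩ := D.covers x v h
        exact ⟨c, ⟨hc, h3⟩, h, h1⟩
    rw [this, Finset.card_erase_of_mem (Finset.mem_univ v), Finset.card_univ, Fintype.card_fin]
  · intro c hc c' hc' hne
    rw [Function.onFun, Finset.disjoint_left]
    intro x h h'
    simp only [Finset.mem_erase, Finset.coe_filter, Set.mem_ofPred_eq] at h h' hc hc'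
    exact hne (D.uniq hc.1 hc'.1 h.1 h.2 hc.2 h'.2 hc'.2)

theorem deg_ge (D : CliqueDecomp r) {S : Finset (Fin r)} (hS : S ∈ D.cliques) (v : Fin r)
    (hv : v ∉ S) : S.card ≤ (D.cliques.filter (fun c => v ∈ c)).card := by
  classical
  have hex : ∀ x : Fin r, ∃ c : Finset (Fin r), x ∈ S → c ∈ D.cliques ∧ v ∈ c ∧ x ∈ c := by
    intro x
    by_cases hx : x ∈ S
    · have hne : v ≠ x := fun h => hv (h ▸ hx)
      obtain ⟨c, h, -⟩ := D.covers v x hne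
      exact ⟨c, fun _ => h⟩
    · exact ⟨∅, fun h => absurd h hx⟩
  choose f hf using hex
  apply Finset.card_le_card_of_injOn f
  · intro x hx
    have := hf x hx
    simp [this.1, this.2.1]
  · intro x hx y hy hxy
    by_contra hne
    have h1 := hf x hx
    have h2 := hf y hy
    rw [← hxy] at h2
    have := D.uniq h1.1 hS hne h1.2.2 h2.2.2 hx hy
    exact hv (this ▸ h1.2.1)

/-- saved pairs -/
def T (n : ℕ) : ℕ := (n - 1) ^ 2 / 4

theorem T_spec (n : ℕ) (hn : 1 ≤ n) : 2 * (n / 2) + 4 * T n = n * n - n := by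
  unfold T
  obtain ⟨m, h | h⟩ := n.even_or_odd'
  · obtain ⟨k, rfl⟩ : ∃ k, m = k + 1 := ⟨m - 1, by omega⟩
    subst h
    have e1 : 2 * (k + 1) - 1 = 2 * k + 1 := by omega
    have e2 : (2 * k + 1) ^ 2 = 4 * (k * k + k) + 1 := by ring
    have e3 : 2 * (k + 1) * (2 * (k + 1)) = 4 * (k * k + k) + 4 * k + 4 := by ring
    rw [e1, e2, e3]
    omega
  · subst h
    have e1 : 2 * m + 1 - 1 = 2 * m := by omega
    have e2 : (2 * m) ^ 2 = 4 * (m * m) := by ring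
    have e3 : (2 * m + 1) * (2 * m + 1) = 4 * (m * m) + 4 * m + 1 := by ring
    rw [e1, e2, e3]
    omega

theorem T_le (n a : ℕ) (ha : n ≤ a + 1) : 2 * T n ≤ a * a - a := by
  unfold T
  have h1 : (n - 1) ^ 2 ≤ a * a := by
    rw [pow_two]
    exact Nat.mul_le_mul (by omega) (by omega)
  have h2 : (n - 1) ^ 2 / 4 ≤ a * a / 4 := Nat.div_le_div_right h1
  rcases Nat.lt_or_ge a 2 with h | h
  · interval_cases a <;> omega
  · have : 2 * a ≤ a * a := Nat.mul_le_mul_right a h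
    omega

theorem M_add (D : CliqueDecomp r) :
    2 * D.M + 4 * ∑ c ∈ D.cliques, T c.card = r * r - r := by
  have h := D.sum_offDiag Finset.univ
  simp only [Finset.inter_univ, Finset.offDiag_card, Finset.card_univ, Fintype.card_fin] at h
  rw [← h, M, Finset.mul_sum, Finset.mul_sum, ← Finset.sum_add_distrib]
  apply Finset.sum_congr rfl
  intro c hc
  exact T_spec _ (by have := D.two_le c hc; omega)

theorem N_le (D : CliqueDecomp r) {S : Finset (Fin r)} (hS : S ∈ D.cliques) :
    2 * ∑ c ∈ D.cliques, T c.card ≤ 2 * T S.card + ((r - S.card) * (r - S.card) - (r - S.card)) := by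
  classical
  have h := D.sum_offDiag Sᶜ
  have hcard : (Sᶜ).card = r - S.card := by rw [Finset.card_compl, Fintype.card_fin]
  rw [Finset.offDiag_card Sᶜ, hcard] at h
  rw [← h, ← Finset.add_sum_erase _ _ hS, mul_add]
  have h2 : 2 * ∑ c ∈ D.cliques.erase S, T c.card
      ≤ ∑ c ∈ D.cliques.erase S, (c ∩ Sᶜ).offDiag.card := by
    rw [Finset.mul_sum]
    apply Finset.sum_le_sum
    intro c hc
    rw [Finset.offDiag_card]
    apply T_le
    obtain ⟨hne, hc⟩ := Finset.mem_erase.1 hc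
    have h3 : (c ∩ S).card ≤ 1 := by
      rw [Finset.card_le_one]
      intro x hx y hy
      by_contra hxy
      simp only [Finset.mem_inter] at hx hy
      exact hne (D.uniq hc hS hxy hx.1 hy.1 hx.2 hy.2)
    have h4 := Finset.card_inter_add_card_sdiff c S
    rw [Finset.sdiff_eq_inter_compl] at h4
    omega
  have h5 : ∑ c ∈ D.cliques.erase S, (c ∩ Sᶜ).offDiag.card
      ≤ ∑ c ∈ D.cliques, (c ∩ Sᶜ).offDiag.card :=
    Finset.sum_le_sum_of_subset (Finset.erase_subset _ _)
  omega

/-- extend a linear family by edges -/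
theorem extend (F : Finset (Finset (Fin r))) (h2 : ∀ c ∈ F, 2 ≤ c.card)
    (hlin : ∀ c ∈ F, ∀ c' ∈ F, ∀ x y, x ≠ y → x ∈ c → y ∈ c → x ∈ c' → y ∈ c' → c = c') :
    ∃ D : CliqueDecomp r, F ⊆ D.cliques ∧ ∀ c ∈ D.cliques, c ∉ F → c.card = 2 := by
  classical
  refine ⟨⟨F ∪ (Finset.univ.powersetCard 2).filter (fun e => ∀ c ∈ F, ¬ e ⊆ c), ?_, ?_⟩, ?_, ?_⟩
  · intro c hc
    rcases Finset.mem_union.1 hc with hc | hc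
    · exact h2 c hc
    · simp only [Finset.mem_filter, Finset.mem_powersetCard] at hc
      omega
  · intro x y hxy
    by_cases hF : ∃ c ∈ F, x ∈ c ∧ y ∈ c
    · obtain ⟨c, hc, hx, hy⟩ := hF
      refine ⟨c, ⟨Finset.mem_union_left _ hc, hx, hy⟩, ?_⟩
      rintro d ⟨hd, hdx, hdy⟩
      rcases Finset.mem_union.1 hd with hd | hd
      · exact hlin d hd c hc x y hxy hdx hdy hx hy
      · exfalso
        simp only [Finset.mem_filter, Finset.mem_powersetCard] at hd
        have : ({x, y} : Finset (Fin r)) = d := by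
          apply Finset.eq_of_subset_of_card_le
          · intro z hz
            simp only [Finset.mem_insert, Finset.mem_singleton] at hz
            rcases hz with rfl | rfl <;> assumption
          · rw [Finset.card_pair hxy]; omega
        apply hd.2 c hc
        rw [← this]
        intro z hz
        simp only [Finset.mem_insert, Finset.mem_singleton] at hz
        rcases hz with rfl | rfl <;> assumption
    · refine ⟨{x, y}, ⟨Finset.mem_union_right _ ?_, by simp, by simp⟩, ?_⟩
      · simp only [Finset.mem_filter, Finset.mem_powersetCard]
        refine ⟨⟨Finset.subset_univ _, Finset.card_pair hxy⟩, ?_⟩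
        intro c hc hsub
        exact hF ⟨c, hc, hsub (by simp), hsub (by simp)⟩
      · rintro d ⟨hd, hdx, hdy⟩
        rcases Finset.mem_union.1 hd with hd | hd
        · exact absurd ⟨d, hd, hdx, hdy⟩ hF
        · simp only [Finset.mem_filter, Finset.mem_powersetCard] at hd
          symm
          apply Finset.eq_of_subset_of_card_le
          · intro z hz
            simp only [Finset.mem_insert, Finset.mem_singleton] at hz
            rcases hz with rfl | rfl <;> assumption
          · rw [Finset.card_pair hxy]; omega
  · exact Finset.subset_union_left
  · intro c hc hcF
    rcases Finset.mem_union.1 hc with hc | hc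
    · exact absurd hc hcF
    · simp only [Finset.mem_filter, Finset.mem_powersetCard] at hc
      exact hc.1.2

theorem pair_of_mem {e : Finset (Fin r)} (he : e.card = 2) {x : Fin r} (hx : x ∈ e) :
    ∃ y, y ≠ x ∧ e = {x, y} := by
  classical
  obtain ⟨a, b, hab, rfl⟩ := Finset.card_eq_two.1 he
  simp only [Finset.mem_insert, Finset.mem_singleton] at hx
  rcases hx with rfl | rfl
  · exact ⟨b, hab.symm, rfl⟩
  · exact ⟨a, hab, Finset.pair_comm _ _⟩

theorem construct (S : Finset (Fin r)) (hS : 2 ≤ S.card) (hr : r ≤ 2 * S.card) (t : ℕ)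
    (ht : t ≤ (r - S.card).choose 2) :
    ∃ D : CliqueDecomp r, D.Simple ∧ ∑ c ∈ D.cliques, T c.card = T S.card + t := by
  classical
  have hcard : (Sᶜ).card = r - S.card := by rw [Finset.card_compl, Fintype.card_fin]
  have : NeZero S.card := ⟨by omega⟩
  -- labels of the outer vertices
  obtain ⟨i, hi⟩ : ∃ i : Fin r → ZMod S.card, Set.InjOn i (Sᶜ : Finset (Fin r)) := by
    have hle : Fintype.card ((Sᶜ : Finset (Fin r)) : Type) ≤ Fintype.card (ZMod S.card) := by
      rw [Fintype.card_coe, ZMod.card]; omega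
    obtain ⟨e⟩ := Function.Embedding.nonempty_of_card_le hle
    refine ⟨fun x => if hx : x ∈ Sᶜ then e ⟨x, hx⟩ else 0, ?_⟩
    intro x hx y hy hxy
    have hx' : x ∈ Sᶜ := hx
    have hy' : y ∈ Sᶜ := hy
    simp only [dif_pos hx', dif_pos hy'] at hxy
    exact congrArg Subtype.val (e.injective hxy)
  obtain ⟨g, hgS, hg⟩ : ∃ g : ZMod S.card → Fin r, (∀ z, g z ∈ S) ∧ Function.Injective g := by
    have e : ZMod S.card ≃ S := Fintype.equivOfCardEq (by rw [ZMod.card, Fintype.card_coe])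
    exact ⟨fun z => e z, fun z => (e z).2, fun a b h => e.injective (Subtype.ext h)⟩
  obtain ⟨P, hPsub, hPcard⟩ : ∃ P ⊆ Sᶜ.powersetCard 2, P.card = t := by
    apply Finset.exists_subset_card_eq
    rw [Finset.card_powersetCard, hcard]; exact ht
  have hP : ∀ e ∈ P, e ⊆ Sᶜ ∧ e.card = 2 := fun e he => Finset.mem_powersetCard.1 (hPsub he)
  let f : Finset (Fin r) → Fin r := fun e => g (∑ x ∈ e, i x)
  have hfS : ∀ e, f e ∈ S := fun e => hgS _
  let tri : Finset (Fin r) → Finset (Fin r) := fun e => insert (f e) e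
  have hout : ∀ e ∈ P, ∀ x ∈ e, x ∉ S := fun e he x hx => Finset.mem_compl.1 ((hP e he).1 hx)
  have htri : ∀ e ∈ P, (tri e).card = 3 := by
    intro e he
    have : f e ∉ e := fun h => hout e he _ h (hfS e)
    simp only [tri]
    rw [Finset.card_insert_of_notMem this, (hP e he).2]
  have hmem : ∀ e ∈ P, ∀ x ∈ tri e, x ∉ S → x ∈ e := by
    intro e he x hx hxS
    rcases Finset.mem_insert.1 hx with h | h
    · exact absurd (h ▸ hfS e) hxS
    · exact h
  have hmemS : ∀ e ∈ P, ∀ x ∈ tri e, x ∈ S → x = f e := by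
    intro e he x hx hxS
    rcases Finset.mem_insert.1 hx with h | h
    · exact h
    · exact absurd hxS (hout e he x h)
  -- one outer vertex and the same colour
  have hmix : ∀ e ∈ P, ∀ e' ∈ P, ∀ x y, x ∉ S → y ∈ S → x ∈ tri e → y ∈ tri e → x ∈ tri e' →
      y ∈ tri e' → e = e' := by
    intro e he e' he' x y hx hy h1 h2 h3 h4
    have hf : f e = f e' := (hmemS e he y h2 hy).symm.trans (hmemS e' he' y h4 hy)
    have hs : ∑ x ∈ e, i x = ∑ x ∈ e', i x := hg hf
    obtain ⟨a, hax, hae⟩ := pair_of_mem (hP e he).2 (hmem e he x h1 hx)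
    obtain ⟨b, hbx, hbe⟩ := pair_of_mem (hP e' he').2 (hmem e' he' x h3 hx)
    have ha : a ∈ Sᶜ := (hP e he).1 (by rw [hae]; simp)
    have hb : b ∈ Sᶜ := (hP e' he').1 (by rw [hbe]; simp)
    rw [hae, hbe, Finset.sum_pair hax.symm, Finset.sum_pair hbx.symm] at hs
    have hab : a = b := hi ha hb (add_left_cancel hs)
    rw [hae, hbe, hab]
  have hTT : ∀ e ∈ P, ∀ e' ∈ P, ∀ x y, x ≠ y → x ∈ tri e → y ∈ tri e → x ∈ tri e' →
      y ∈ tri e' → e = e' := by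
    intro e he e' he' x y hxy h1 h2 h3 h4
    by_cases hx : x ∈ S
    · by_cases hy : y ∈ S
      · exact absurd ((hmemS e he x h1 hx).trans (hmemS e he y h2 hy).symm) hxy
      · exact hmix e he e' he' y x hy hx h2 h1 h4 h3
    · by_cases hy : y ∈ S
      · exact hmix e he e' he' x y hx hy h1 h2 h3 h4
      · have key : ∀ d ∈ P, x ∈ tri d → y ∈ tri d → ({x, y} : Finset (Fin r)) = d := by
          intro d hd k1 k2
          apply Finset.eq_of_subset_of_card_le
          · intro z hz
            simp only [Finset.mem_insert, Finset.mem_singleton] at hz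
            rcases hz with rfl | rfl
            · exact hmem d hd _ k1 hx
            · exact hmem d hd _ k2 hy
          · rw [Finset.card_pair hxy, (hP d hd).2]
        rw [← key e he h1 h2, ← key e' he' h3 h4]
  have hST : ∀ e ∈ P, ∀ x y, x ≠ y → x ∈ tri e → y ∈ tri e → x ∈ S → y ∈ S → False := by
    intro e he x y hxy h1 h2 hx hy
    exact hxy ((hmemS e he x h1 hx).trans (hmemS e he y h2 hy).symm)
  have hinj : Set.InjOn tri P := by
    intro e he e' he' h
    obtain ⟨a, b, hab, hE⟩ := Finset.card_eq_two.1 (hP e he).2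
    have h1 : a ∈ tri e := Finset.mem_insert_of_mem (by rw [hE]; simp)
    have h2 : b ∈ tri e := Finset.mem_insert_of_mem (by rw [hE]; simp)
    exact hTT e he e' he' a b hab h1 h2 (h ▸ h1) (h ▸ h2)
  have hSn : S ∉ P.image tri := by
    intro h
    obtain ⟨e, he, h⟩ := Finset.mem_image.1 h
    obtain ⟨a, b, hab, hE⟩ := Finset.card_eq_two.1 (hP e he).2
    have h1 : a ∈ tri e := Finset.mem_insert_of_mem (by rw [hE]; simp)
    rw [h] at h1
    exact hout e he a (by rw [hE]; simp) h1
  obtain ⟨D, hsub, hrest⟩ := extend (insert S (P.image tri))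
    (by
      intro c hc
      rcases Finset.mem_insert.1 hc with rfl | hc
      · exact hS
      · obtain ⟨e, he, rfl⟩ := Finset.mem_image.1 hc
        rw [htri e he]; omega)
    (by
      intro c hc c' hc' x y hxy h1 h2 h3 h4
      rcases Finset.mem_insert.1 hc with rfl | hc
      · rcases Finset.mem_insert.1 hc' with rfl | hc'
        · rfl
        · obtain ⟨e, he, rfl⟩ := Finset.mem_image.1 hc'
          exact (hST e he x y hxy h3 h4 h1 h2).elim
      · obtain ⟨e, he, rfl⟩ := Finset.mem_image.1 hc
        rcases Finset.mem_insert.1 hc' with rfl | hc'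
        · exact (hST e he x y hxy h1 h2 h3 h4).elim
        · obtain ⟨e', he', rfl⟩ := Finset.mem_image.1 hc'
          rw [hTT e he e' he' x y hxy h1 h2 h3 h4])
  refine ⟨D, ?_, ?_⟩
  · unfold Simple
    apply (Finset.card_le_card (t := {S}) _).trans
    · simp
    · intro c hc
      obtain ⟨hc, hc3⟩ := Finset.mem_filter.1 hc
      by_cases hcF : c ∈ insert S (P.image tri)
      · rcases Finset.mem_insert.1 hcF with rfl | h
        · simp
        · obtain ⟨e, he, rfl⟩ := Finset.mem_image.1 h
          rw [htri e he] at hc3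
          omega
      · have := hrest c hc hcF
        omega
  · rw [← Finset.sum_subset hsub]
    · rw [Finset.sum_insert hSn, Finset.sum_image hinj]
      congr 1
      rw [Finset.sum_congr rfl (g := fun _ => 1)]
      · simp [hPcard]
      · intro e he
        rw [htri e he]; rfl
    · intro c hc hcF
      rw [hrest c hc hcF]; rfl

theorem sum_swap (D : CliqueDecomp r) (w : Finset (Fin r) → ℝ) :
    ∑ v : Fin r, ∑ c ∈ D.cliques with v ∈ c, w c = ∑ c ∈ D.cliques, (c.card : ℝ) * w c := by
  classical
  simp only [Finset.sum_filter]
  rw [Finset.sum_comm]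
  apply Finset.sum_congr rfl
  intro c _
  rw [← Finset.sum_filter, Finset.sum_const, nsmul_eq_mul]
  congr 3
  ext x; simp

theorem sum_deg_real (D : CliqueDecomp r) (v : Fin r) :
    ∑ c ∈ D.cliques with v ∈ c, ((c.card : ℝ) - 1) = (r : ℝ) - 1 := by
  have h := congrArg (Nat.cast (R := ℝ)) (D.sum_deg v)
  have hr : 1 ≤ r := by have := v.2; omega
  rw [Nat.cast_sum, Nat.cast_sub hr] at h
  rw [← Nat.cast_one (R := ℝ), ← h]
  apply Finset.sum_congr rfl
  intro c hc
  have := D.two_le c (Finset.mem_filter.1 hc).1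
  rw [Nat.cast_sub (by omega)]

theorem half_ge (n : ℕ) : (n : ℝ) - 1 ≤ 2 * ((n / 2 : ℕ) : ℝ) := by
  have : n ≤ 2 * (n / 2) + 1 := by omega
  have h : (n : ℝ) ≤ 2 * ((n / 2 : ℕ) : ℝ) + 1 := by exact_mod_cast this
  linarith

/-- weight of a vertex in a clique of size `n` -/
noncomputable def wt (n : ℕ) : ℝ := 2 * ((n / 2 : ℕ) : ℝ) / n

theorem wt_ge1 (n s : ℕ) (hn : 2 ≤ n) (hs : n ≤ s) : ((n : ℝ) - 1) / s ≤ wt n := by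
  unfold wt
  have h2 : (2 : ℝ) ≤ n := by exact_mod_cast hn
  have hs' : (n : ℝ) ≤ s := by exact_mod_cast hs
  have := half_ge n
  apply div_le_div₀ (by positivity) this (by linarith) hs'

theorem wt_ge2 (n s : ℕ) (hn : 2 ≤ n) (hs : n ≤ s) :
    (2 * ((s : ℝ) - 1) + ((n : ℝ) - 1)) / (3 * s) ≤ wt n := by
  unfold wt
  have h2 : (2 : ℝ) ≤ n := by exact_mod_cast hn
  have hs' : (n : ℝ) ≤ s := by exact_mod_cast hs
  rw [div_le_div_iff₀ (by linarith) (by linarith)]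
  rcases n.even_or_odd' with ⟨m, h | h⟩
  · have e : n / 2 = m := by omega
    rw [e]
    have : (n : ℝ) = 2 * m := by rw [h]; push_cast; ring
    rw [← this]
    nlinarith
  · have e : n / 2 = m := by omega
    rw [e]
    have e2 : (n : ℝ) = 2 * m + 1 := by rw [h]; push_cast; ring
    have h3 : (3 : ℝ) ≤ n := by exact_mod_cast (by omega : 3 ≤ n)
    have : (2 : ℝ) * m = n - 1 := by linarith
    rw [this]
    nlinarith [mul_nonneg (sub_nonneg.2 h3) (sub_nonneg.2 hs')]

theorem sum_wt (D : CliqueDecomp r) :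
    ∑ v : Fin r, ∑ c ∈ D.cliques with v ∈ c, wt c.card = 2 * D.M := by
  rw [D.sum_swap (fun c => wt c.card), M, Nat.cast_sum, Finset.mul_sum]
  apply Finset.sum_congr rfl
  intro c hc
  have := D.two_le c hc
  have h2 : (2 : ℝ) ≤ c.card := by exact_mod_cast this
  unfold wt
  field_simp

theorem vertex1 (D : CliqueDecomp r) (s : ℕ) (hmax : ∀ c ∈ D.cliques, c.card ≤ s) (v : Fin r) :
    ((r : ℝ) - 1) / s ≤ ∑ c ∈ D.cliques with v ∈ c, wt c.card := by
  rw [← D.sum_deg_real v, Finset.sum_div]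
  apply Finset.sum_le_sum
  intro c hc
  have hc := (Finset.mem_filter.1 hc).1
  exact wt_ge1 _ _ (D.two_le c hc) (hmax c hc)

theorem vertex2 (D : CliqueDecomp r) {S : Finset (Fin r)} (hS : S ∈ D.cliques)
    (hmax : ∀ c ∈ D.cliques, c.card ≤ S.card) (v : Fin r) (hv : v ∉ S) :
    (2 * (S.card : ℝ) * (S.card - 1) + ((r : ℝ) - 1)) / (3 * S.card)
      ≤ ∑ c ∈ D.cliques with v ∈ c, wt c.card := by
  have h2 : (2 : ℝ) ≤ S.card := by exact_mod_cast D.two_le S hS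
  have h1 : ∑ c ∈ D.cliques with v ∈ c, (2 * ((S.card : ℝ) - 1) + ((c.card : ℝ) - 1)) / (3 * S.card)
      ≤ ∑ c ∈ D.cliques with v ∈ c, wt c.card := by
    apply Finset.sum_le_sum
    intro c hc
    have hc := (Finset.mem_filter.1 hc).1
    exact wt_ge2 _ _ (D.two_le c hc) (hmax c hc)
  refine le_trans ?_ h1
  rw [← Finset.sum_div, Finset.sum_add_distrib, D.sum_deg_real v, Finset.sum_const, nsmul_eq_mul]
  have hd : (S.card : ℝ) ≤ ((D.cliques.filter (fun c => v ∈ c)).card : ℝ) := by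
    exact_mod_cast D.deg_ge hS v hv
  apply div_le_div_of_nonneg_right _ (by positivity)
  nlinarith

theorem bound1 (D : CliqueDecomp r) {S : Finset (Fin r)} (hS : S ∈ D.cliques)
    (hmax : ∀ c ∈ D.cliques, c.card ≤ S.card) :
    (r : ℝ) * (r - 1) ≤ 2 * D.M * S.card := by
  have h2 : (2 : ℝ) ≤ S.card := by exact_mod_cast D.two_le S hS
  have h : ∑ v : Fin r, ((r : ℝ) - 1) / S.card ≤ 2 * D.M := by
    rw [← D.sum_wt]
    exact Finset.sum_le_sum (fun v _ => D.vertex1 _ hmax v)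
  rw [Finset.sum_const, nsmul_eq_mul, Finset.card_univ, Fintype.card_fin, ← mul_div_assoc,
    div_le_iff₀ (by linarith)] at h
  exact h

theorem bound2 (D : CliqueDecomp r) {S : Finset (Fin r)} (hS : S ∈ D.cliques)
    (hmax : ∀ c ∈ D.cliques, c.card ≤ S.card) :
    ((r : ℝ) - S.card) * (2 * S.card * (S.card - 1) + (r - 1)) + 3 * S.card * (r - 1)
      ≤ 6 * D.M * S.card := by
  classical
  have h2 : (2 : ℝ) ≤ S.card := by exact_mod_cast D.two_le S hS
  have hle : S.card ≤ r := by simpa using S.card_le_univ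
  have hc : ((Sᶜ).card : ℝ) = r - S.card := by
    rw [Finset.card_compl, Fintype.card_fin, Nat.cast_sub hle]
  have h : ∑ v ∈ S, ((r : ℝ) - 1) / S.card
      + ∑ v ∈ Sᶜ, (2 * (S.card : ℝ) * (S.card - 1) + ((r : ℝ) - 1)) / (3 * S.card) ≤ 2 * D.M := by
    rw [← D.sum_wt, ← Finset.sum_add_sum_compl S]
    exact add_le_add (Finset.sum_le_sum (fun v _ => D.vertex1 _ hmax v))
      (Finset.sum_le_sum (fun v hv => D.vertex2 hS hmax v (Finset.mem_compl.1 hv)))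
  rw [Finset.sum_const, Finset.sum_const, nsmul_eq_mul, nsmul_eq_mul, hc] at h
  have hs : (S.card : ℝ) ≠ 0 := by linarith
  have e : (S.card : ℝ) * (((r : ℝ) - 1) / S.card)
      + ((r : ℝ) - S.card) * ((2 * (S.card : ℝ) * (S.card - 1) + ((r : ℝ) - 1)) / (3 * S.card))
      = (((r : ℝ) - S.card) * (2 * S.card * (S.card - 1) + (r - 1)) + 3 * S.card * (r - 1))
        / (3 * S.card) := by
    field_simp
    ring
  rw [e, div_le_iff₀ (by linarith)] at h
  linarith

theorem arith (r s m : ℕ) (q : ℝ) (hq : 0 < q) (hr : (r : ℝ) = q ^ 2 + q + 1)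
    (hs : 2 * s + 1 ≤ r) (hm : 2 * (m : ℝ) < r * q)
    (h1 : (r : ℝ) * (r - 1) ≤ 2 * m * s)
    (h2 : ((r : ℝ) - s) * (2 * s * (s - 1) + (r - 1)) + 3 * s * (r - 1) ≤ 6 * m * s) : False := by
  have hr0 : (0 : ℝ) < r := by rw [hr]; positivity
  have hs0 : (0 : ℝ) < s := by
    rcases Nat.eq_zero_or_pos s with h | h
    · exfalso
      rw [h, hr] at h1
      have : 0 < (q ^ 2 + q + 1) * (q ^ 2 + q + 1 - 1) := by
        have : q ^ 2 + q + 1 - 1 = q ^ 2 + q := by ring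
        rw [this]; positivity
      simp at h1
      nlinarith
    · exact_mod_cast h
  have hsq : q + 1 < s := by
    have a1 : 2 * (m : ℝ) * s < r * q * s := mul_lt_mul_of_pos_right hm hs0
    have a2 : (r : ℝ) * (r - 1) = (r * q) * (q + 1) := by rw [hr]; ring
    have a3 : (r * q) * (q + 1) < (r * q) * s := by linarith
    exact lt_of_mul_lt_mul_left a3 (by positivity)
  have hs2 : 2 * (s : ℝ) + 1 ≤ r := by exact_mod_cast hs
  have hrs : (r : ℝ) < s * (s - 1) + 1 := by rw [hr]; nlinarith
  have hrs' : r < s * s - s + 1 := by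
    have hle : s ≤ s * s := Nat.le_mul_self s
    have : (r : ℝ) < ((s * s - s + 1 : ℕ) : ℝ) := by
      push_cast [Nat.cast_sub hle]
      linarith
    exact_mod_cast this
  have hs4 : 4 ≤ s := by
    by_contra hlt
    have : s ≤ 3 := by omega
    interval_cases s <;> omega
  by_cases hbig : 11 ≤ r
  · have hr11 : (11 : ℝ) ≤ r := by exact_mod_cast hbig
    have hq27 : 2.7 < q := by
      by_contra hcon
      have : q ≤ 2.7 := by linarith
      nlinarith
    have hG : -2 * (s : ℝ) ^ 2 + (2 * r - 2 * q) * s - r * q < 0 := by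
      have hfac : (s - (q + 1)) * (-2 * (s : ℝ) ^ 2 + (2 * r - 2 * q) * s - r * q) < 0 := by
        have a1 : 2 * (m : ℝ) * s < r * q * s := mul_lt_mul_of_pos_right hm hs0
        have e : (s - (q + 1)) * (-2 * (s : ℝ) ^ 2 + (2 * r - 2 * q) * s - r * q)
          = ((r : ℝ) - s) * (2 * s * (s - 1) + (r - 1)) + 3 * s * (r - 1) - 3 * (r * q * s) := by
          rw [hr]; ring
        rw [e]; linarith
      by_contra hcon
      have : 0 ≤ (s - (q + 1)) * (-2 * (s : ℝ) ^ 2 + (2 * r - 2 * q) * s - r * q) :=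
        mul_nonneg (by linarith) (by linarith)
      linarith
    -- concavity
    have hA : 0 ≤ q * (q ^ 2 - q - 3) := mul_nonneg hq.le (by nlinarith)
    have hB : 0 ≤ (r : ℝ) * (r / 2 - 2 * q) := mul_nonneg hr0.le (by rw [hr]; nlinarith)
    have ha : (0 : ℝ) < s - (q + 1) := by linarith
    have hb : (0 : ℝ) < r / 2 - s := by linarith
    have hid : ((r : ℝ) / 2 - (q + 1)) * (-2 * (s : ℝ) ^ 2 + (2 * r - 2 * q) * s - r * q)
        = 2 * (s - (q + 1)) * (r / 2 - s) * ((r : ℝ) / 2 - (q + 1))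
          + (r / 2 - s) * (q * (q ^ 2 - q - 3)) + (s - (q + 1)) * (r * (r / 2 - 2 * q)) := by
      rw [hr]; ring
    have hpos : (0 : ℝ) < (r : ℝ) / 2 - (q + 1) := by linarith
    have : 0 ≤ ((r : ℝ) / 2 - (q + 1)) * (-2 * (s : ℝ) ^ 2 + (2 * r - 2 * q) * s - r * q) := by
      rw [hid]; positivity
    have := mul_neg_of_pos_of_neg hpos hG
    linarith
  · have hs' : s = 4 := by omega
    subst hs'
    have hr' : r = 9 ∨ r = 10 := by omega
    rcases hr' with rfl | rfl
    · have : (10 : ℝ) < m := by norm_num at h2; linarith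
      have : 10 < m := by exact_mod_cast this
      have : (11 : ℝ) ≤ m := by exact_mod_cast this
      norm_num at hm hr
      nlinarith
    · have : (12 : ℝ) < m := by norm_num at h2; linarith
      have : 12 < m := by exact_mod_cast this
      have : (13 : ℝ) ≤ m := by exact_mod_cast this
      norm_num at hm hr
      nlinarith

end CliqueDecomp

/-- If `Π` is an edge-decomposition of `K_r` with
`M(Π) < (1/4)·r·(√(4r − 3) − 1)`, then there is a simple edge-decomposition
`Π'` of `K_r` with `M(Π') = M(Π)`. -/
theorem stmt10 (r : ℕ) (hr : 1 ≤ r) (D : CliqueDecomp r)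
    (h : (D.M : ℝ) < (1 / 4) * (r : ℝ) * (Real.sqrt (4 * (r : ℝ) - 3) - 1)) :
    ∃ D' : CliqueDecomp r, D'.Simple ∧ D'.M = D.M := by
  classical
  rcases Nat.lt_or_ge r 2 with hr2 | hr2
  · exfalso
    have : r = 1 := by omega
    subst this
    have h0 : (0 : ℝ) ≤ D.M := Nat.cast_nonneg _
    have : (4 : ℝ) * ((1 : ℕ) : ℝ) - 3 = 1 := by norm_num
    rw [this, Real.sqrt_one] at h
    linarith
  have hne : D.cliques.Nonempty := by
    obtain ⟨c, ⟨hc, -⟩, -⟩ := D.covers ⟨0, by omega⟩ ⟨1, by omega⟩ (by simp)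
    exact ⟨c, hc⟩
  obtain ⟨S, hS, hmax⟩ := Finset.exists_max_image D.cliques Finset.card hne
  have hr2' : (2 : ℝ) ≤ r := by exact_mod_cast hr2
  have hcase : r ≤ 2 * S.card := by
    by_contra hcon
    have hsq := Real.sq_sqrt (show (0 : ℝ) ≤ 4 * (r : ℝ) - 3 by linarith)
    have hgt : 1 < Real.sqrt (4 * (r : ℝ) - 3) := by
      rw [Real.lt_sqrt (by norm_num)]; linarith
    refine CliqueDecomp.arith r S.card D.M ((Real.sqrt (4 * (r : ℝ) - 3) - 1) / 2)
      (by linarith) (by nlinarith) (by omega) (by linarith) (D.bound1 hS hmax) (D.bound2 hS hmax)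
  have hN := D.N_le hS
  have hle : CliqueDecomp.T S.card ≤ ∑ c ∈ D.cliques, CliqueDecomp.T c.card :=
    Finset.single_le_sum (f := fun c : Finset (Fin r) => CliqueDecomp.T c.card)
      (fun _ _ => Nat.zero_le _) hS
  obtain ⟨D', hD', hsum⟩ := CliqueDecomp.construct S (D.two_le S hS) hcase
    (∑ c ∈ D.cliques, CliqueDecomp.T c.card - CliqueDecomp.T S.card)
    (by
      rw [Nat.choose_two_right, Nat.le_div_iff_mul_le (by norm_num), Nat.mul_sub, mul_one]
      omega)
  refine ⟨D', hD', ?_⟩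
  have e1 := D.M_add
  have e2 := D'.M_add
  omega
end

section
/- Fix an integer r with 0 ≤ r ≤ q + 1, and let Π be a simple edge-decomposition of K_r into cliques of orders r₁ ≥ r₂ ≥ … ≥ r_n, where r₁ ≥ max{(2r − 3)/3, (2r − 3) − (q + 1)}. Then Π can be realized in PG(2,q): there exists a set S of exactly r points of PG(2,q) such that the multiset of intersection sizes {|ℓ ∩ S| : ℓ ∈ ℒ, |ℓ ∩ S| ≥ 2} equals the multiset {r₁, …, r_n}. -/
open scoped BigOperators

/-- Points (and, by self-duality of homogeneous coordinates, lines) of the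
Desarguesian projective plane `PG(2,q)` over the field `F`. -/
abbrev PG (F : Type*) [Field F] := Projectivization F (Fin 3 → F)

/-- Incidence between a point and a line (the line being given by its dual
homogeneous coordinates): the dot product of representatives vanishes.
This does not depend on the choice of representatives. -/
def Incid {F : Type*} [Field F] (p l : PG F) : Prop :=
  ∑ i, p.rep i * l.rep i = 0

/-- `𝒫ᵒ(R)`: points incident with an odd number of lines of `R`. -/
def Podd (F : Type*) [Field F] (R : Set (PG F)) : Set (PG F) :=
  {p | Odd {l ∈ R | Incid p l}.ncard}

/-- `𝒫ᵉ(R)`: points incident with an even number of lines of `R`. -/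
def Peven (F : Type*) [Field F] (R : Set (PG F)) : Set (PG F) :=
  {p | Even {l ∈ R | Incid p l}.ncard}

/-- `ℒᵒ(S)`: lines meeting `S` in an odd number of points. -/
def Lodd (F : Type*) [Field F] (S : Set (PG F)) : Set (PG F) :=
  {l | Odd {p ∈ S | Incid p l}.ncard}

/-- `ℒᵉ(S)`: lines meeting `S` in an even number of points. -/
def Leven (F : Type*) [Field F] (S : Set (PG F)) : Set (PG F) :=
  {l | Even {p ∈ S | Incid p l}.ncard}

/-- `f(r)`: the minimum size of the symmetric difference of `r` distinct lines,
i.e. the minimum of `|𝒫ᵒ(R)|` over sets `R` of exactly `r` lines. -/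
noncomputable def fmin (F : Type*) [Field F] (r : ℕ) : ℕ :=
  sInf {n | ∃ R : Set (PG F), R.ncard = r ∧ (Podd F R).ncard = n}

section Comb
open Finset

/-- Subset sums: if the weights have no gaps, every value up to the total is attained. -/
lemma subset_sum_attained (U : Finset ℕ) (w : ℕ → ℕ)
    (hw : ∀ u ∈ U, 2 ≤ w u → ∃ v ∈ U, w v + 1 = w u) (t : ℕ) (ht : t ≤ ∑ u ∈ U, w u) :
    ∃ T ⊆ U, ∑ u ∈ T, w u = t := by
  classical
  obtain ⟨T, hT, hmaxT⟩ := (U.powerset.filter (fun T => ∑ u ∈ T, w u ≤ t)).exists_max_image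
    (fun T => ∑ u ∈ T, w u) ⟨∅, by simp⟩
  simp only [mem_filter, mem_powerset] at hT hmaxT
  refine ⟨T, hT.1, ?_⟩
  by_contra hne
  have hlt : ∑ u ∈ T, w u < t := lt_of_le_of_ne hT.2 hne
  have hex : ∃ u ∈ U \ T, 0 < w u := by
    by_contra hcon
    push Not at hcon
    have h0 : ∑ u ∈ U \ T, w u = 0 := sum_eq_zero (fun u hu => Nat.le_zero.mp (hcon u hu))
    have := sum_sdiff (f := w) hT.1
    omega
  obtain ⟨u, hu, hmin⟩ := ((U \ T).filter (fun u => 0 < w u)).exists_min_image w (by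
    obtain ⟨u, hu, h⟩ := hex
    exact ⟨u, by simp only [mem_filter]; exact ⟨hu, h⟩⟩)
  simp only [mem_filter, mem_sdiff] at hu hmin
  obtain ⟨⟨huU, huT⟩, hupos⟩ := hu
  have hbig : t < w u + ∑ v ∈ T, w v := by
    by_contra hcon
    have := hmaxT (insert u T) ⟨insert_subset huU hT.1, by rw [sum_insert huT]; omega⟩
    rw [sum_insert huT] at this
    omega
  obtain ⟨v, hvU, hv⟩ := hw u huU (by omega)
  have hvT : v ∈ T := by
    by_contra hvT
    have := hmin v ⟨⟨hvU, hvT⟩, by omega⟩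
    omega
  have huT' : u ∉ T.erase v := fun h => huT (mem_of_mem_erase h)
  have hs := add_sum_erase T w hvT
  have := hmaxT (insert u (T.erase v)) ⟨insert_subset huU ((erase_subset _ _).trans hT.1), by
    rw [sum_insert huT']; omega⟩
  rw [sum_insert huT'] at this
  omega

/-- The pairs `i < j < k`. -/
def ltPairs (k : ℕ) : Finset (ℕ × ℕ) := (range k ×ˢ range k).filter (fun p => p.1 < p.2)

lemma mem_ltPairs {k : ℕ} {p : ℕ × ℕ} : p ∈ ltPairs k ↔ p.1 < p.2 ∧ p.2 < k := by
  simp only [ltPairs, mem_filter, mem_product, mem_range]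
  omega

lemma card_ltPairs_sum (k s : ℕ) :
    ((ltPairs k).filter (fun p => p.1 + p.2 = s)).card = (s + 1) / 2 - (s + 1 - k) := by
  rw [← Nat.card_Ico]
  symm
  apply card_bij (fun i _ => (i, s - i))
  · intro i hi
    simp only [mem_Ico] at hi
    simp only [mem_filter, mem_ltPairs]
    omega
  · intro i _ j _ h
    exact (Prod.mk.inj h).1
  · rintro ⟨i, j⟩ h
    simp only [mem_filter, mem_ltPairs] at h
    refine ⟨i, by simp only [mem_Ico]; omega, ?_⟩
    ext <;> simp; omega

lemma card_ltPairs (k : ℕ) : (ltPairs k).card = k.choose 2 := by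
  have h : ∀ p ∈ ltPairs k, p.2 ∈ range k := fun p hp => by
    rw [mem_ltPairs] at hp; simp [hp.2]
  rw [card_eq_sum_card_fiberwise h]
  have : ∀ j ∈ range k, ((ltPairs k).filter (fun p => p.2 = j)).card = j := by
    intro j hj
    rw [mem_range] at hj
    conv_rhs => rw [← card_range j]
    symm
    apply card_bij (fun i _ => (i, j))
    · intro i hi
      simp only [mem_range] at hi
      simp [mem_filter, mem_ltPairs, hi, hj]
    · intro i _ i' _ h
      exact (Prod.mk.inj h).1
    · rintro ⟨i, j'⟩ h
      simp only [mem_filter, mem_ltPairs] at h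
      exact ⟨i, by simp only [mem_range]; omega, Prod.ext rfl h.2.symm⟩
  rw [sum_congr rfl this, sum_range_id, Nat.choose_two_right]

lemma exists_sum_set (k t : ℕ) (ht : t ≤ k.choose 2) :
    ∃ T ⊆ Ico 1 (2 * k - 2), ((ltPairs k).filter (fun p => p.1 + p.2 ∈ T)).card = t := by
  classical
  have key : ∀ T : Finset ℕ, ((ltPairs k).filter (fun p => p.1 + p.2 ∈ T)).card =
      ∑ s ∈ T, ((s + 1) / 2 - (s + 1 - k)) := by
    intro T
    rw [card_eq_sum_card_fiberwise (f := fun p : ℕ × ℕ => p.1 + p.2) (t := T)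
      (fun p hp => by simpa using (mem_filter.mp hp).2)]
    refine sum_congr rfl fun s hs => ?_
    rw [← card_ltPairs_sum, filter_filter]
    congr 1
    apply filter_congr
    intro p _
    constructor
    · exact fun h => h.2
    · exact fun h => ⟨h ▸ hs, h⟩
  have hall : (ltPairs k).filter (fun p => p.1 + p.2 ∈ Ico 1 (2 * k - 2)) = ltPairs k := by
    apply filter_true_of_mem
    intro p hp
    rw [mem_ltPairs] at hp
    rw [mem_Ico]
    omega
  obtain ⟨T, hT, hs⟩ := subset_sum_attained (Ico 1 (2 * k - 2))
    (fun s => (s + 1) / 2 - (s + 1 - k)) (by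
      intro u hu h2
      simp only [mem_Ico] at hu ⊢
      by_cases h : u + 1 ≤ k
      · exact ⟨u - 2, by omega, by omega⟩
      · exact ⟨u + 2, by omega, by omega⟩) t (by rw [← key, hall, card_ltPairs]; exact ht)
  exact ⟨T, hT, by rw [key, hs]⟩

/-- Choosing the points on the line at infinity. -/
lemma exists_M {F : Type*} [Field F] [Fintype F] [DecidableEq F] (k r₁ t : ℕ)
    (hr : r₁ + k ≤ Fintype.card F + 1) (h1 : 2 * k ≤ r₁ + 3)
    (h2 : r₁ + 2 * k ≤ Fintype.card F + 4) (hq : 3 ≤ Fintype.card F)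
    (hodd : Odd (Fintype.card F))
    (ht : t ≤ k.choose 2) :
    ∃ x : ℕ → F, (∀ i, x i ≠ 0) ∧ (∀ i < k, ∀ j < k, x i = x j → i = j) ∧
      ∃ M : Finset (Option F), M.card = r₁ ∧
        ((ltPairs k).filter (fun p => some (x p.1 * x p.2) ∈ M)).card = t := by
  classical
  obtain ⟨g, hg⟩ := IsCyclic.exists_ofOrder_eq_natCard (α := Fˣ)
  rw [Nat.card_units, Nat.card_eq_fintype_card] at hg
  obtain ⟨m, hm⟩ := hodd
  have hinj : ∀ i < Fintype.card F - 1, ∀ j < Fintype.card F - 1,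
      ((g ^ i : Fˣ) : F) = ((g ^ j : Fˣ) : F) → i = j := by
    intro i hi j hj h
    exact pow_injOn_Iio_orderOf (by simpa [hg] using hi) (by simpa [hg] using hj) (Units.ext h)
  obtain ⟨T, hTU, hT⟩ := exists_sum_set k t ht
  have hTc := card_le_card hTU
  rw [Nat.card_Ico] at hTc
  let f : ℕ → Option F := fun s => some ((g ^ s : Fˣ) : F)
  have hf : Set.InjOn f (Ico 1 (2 * k - 2) : Finset ℕ) := by
    intro i hi j hj h
    simp only [coe_Ico, Set.mem_Ico] at hi hj
    exact hinj i (by omega) j (by omega) (Option.some.inj h)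
  have hUc : ((Ico 1 (2 * k - 2)).image f).card = 2 * k - 2 - 1 := by
    rw [card_image_of_injOn hf, Nat.card_Ico]
  have hZ : (univ \ (Ico 1 (2 * k - 2)).image f).card = Fintype.card F + 1 - (2 * k - 2 - 1) := by
    rw [card_sdiff_of_subset (subset_univ _), hUc, card_univ, Fintype.card_option]
  obtain ⟨Z, hZs, hZc⟩ := exists_subset_card_eq (s := univ \ (Ico 1 (2 * k - 2)).image f)
    (n := r₁ - T.card) (by rw [hZ]; omega)
  refine ⟨fun i => ((g ^ i : Fˣ) : F), fun i => Units.ne_zero _, ?_, T.image f ∪ Z, ?_, ?_⟩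
  · intro i hi j hj h
    exact hinj i (by omega) j (by omega) h
  · rw [card_union_of_disjoint, card_image_of_injOn (hf.mono (by exact_mod_cast hTU)), hZc]
    · omega
    · rw [disjoint_left]
      intro a ha haZ
      have := hZs haZ
      rw [mem_sdiff] at this
      exact this.2 (image_subset_image hTU ha)
  · rw [← hT]
    congr 1
    apply filter_congr
    intro p hp
    rw [mem_ltPairs] at hp
    have hpU : p.1 + p.2 ∈ Ico 1 (2 * k - 2) := by rw [mem_Ico]; omega
    have he : some (((g ^ p.1 : Fˣ) : F) * ((g ^ p.2 : Fˣ) : F)) = f (p.1 + p.2) := by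
      simp [f, pow_add]
    rw [he, mem_union]
    constructor
    · rintro (h | h)
      · obtain ⟨s, hs, hse⟩ := mem_image.mp h
        have := hf (by exact_mod_cast hTU hs) (by exact_mod_cast hpU) hse
        rwa [← this]
      · have := hZs h
        rw [mem_sdiff] at this
        exact absurd (mem_image_of_mem f hpU) this.2
    · exact fun h => Or.inl (mem_image_of_mem f h)

end Comb
section Geom
open Finset

/-- Abstract counting of the intersection sizes. -/
lemma geom_count {P L O : Type*} [DecidableEq P] [Fintype L] [DecidableEq L] [DecidableEq O]
    (I : P → L → Prop) [∀ p l, Decidable (I p l)]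
    (hI : ∀ p p' l l', I p l → I p' l → I p l' → I p' l' → p = p' ∨ l = l')
    (k : ℕ) (a : ℕ → P) (b : O → P) (M : Finset O) (l₀ : L) (G : ℕ → ℕ → L) (d : ℕ → ℕ → O)
    (hb0 : ∀ o, I (b o) l₀) (ha0 : ∀ i, ¬ I (a i) l₀) (hb : Function.Injective b)
    (ha : ∀ i < k, ∀ j < k, a i = a j → i = j)
    (hG1 : ∀ i j, I (a i) (G i j)) (hG2 : ∀ i j, I (a j) (G i j))
    (hG3 : ∀ i < k, ∀ j < k, ∀ m < k, I (a m) (G i j) → m = i ∨ m = j)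
    (hG4 : ∀ i j o, I (b o) (G i j) ↔ o = d i j) :
    ∃ S : Finset P, S.card = M.card + k ∧ (S.filter (fun p => I p l₀)).card = M.card ∧
      (∀ l, l ≠ l₀ → (S.filter (fun p => I p l)).card ≤ 3) ∧
      (univ.filter (fun l => l ≠ l₀ ∧ (S.filter (fun p => I p l)).card = 3)).card =
        ((ltPairs k).filter (fun p => d p.1 p.2 ∈ M)).card := by
  have haO : Set.InjOn a (range k : Finset ℕ) := by
    intro i hi j hj h
    exact ha i (by simpa using hi) j (by simpa using hj) h
  have hdis : ∀ i o, a i ≠ b o := fun i o h => ha0 i (h ▸ hb0 o)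
  have hcard : ∀ X ⊆ range k, ∀ Y : Finset O, (X.image a ∪ Y.image b).card = X.card + Y.card := by
    intro X hX Y
    rw [card_union_of_disjoint, card_image_of_injOn (haO.mono (by exact_mod_cast hX)),
      card_image_of_injective _ hb]
    rw [disjoint_left]
    intro p hp hp'
    obtain ⟨i, _, rfl⟩ := mem_image.mp hp
    obtain ⟨o, _, h⟩ := mem_image.mp hp'
    exact hdis i o h.symm
  have hline : ∀ l, (((range k).image a ∪ M.image b).filter (fun p => I p l)).card =
      ((range k).filter (fun i => I (a i) l)).card + (M.filter (fun o => I (b o) l)).card := by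
    intro l
    rw [filter_union, filter_image, filter_image, hcard _ (filter_subset _ _)]
  have hM1 : ∀ l, l ≠ l₀ → (M.filter (fun o => I (b o) l)).card ≤ 1 := by
    intro l hl
    rw [card_le_one]
    intro o ho o' ho'
    rw [mem_filter] at ho ho'
    rcases hI _ _ _ _ ho.2 ho'.2 (hb0 o) (hb0 o') with h | h
    · exact hb h
    · exact absurd h hl
  have hGeq : ∀ i < k, ∀ j < k, i ≠ j → ∀ l, I (a i) l → I (a j) l → l = G i j := by
    intro i hi j hj hij l h1 h2
    rcases hI _ _ _ _ h1 h2 (hG1 i j) (hG2 i j) with h | h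
    · exact absurd (ha i hi j hj h) hij
    · exact h
  have hGf : ∀ i < k, ∀ j < k, (range k).filter (fun m => I (a m) (G i j)) = {i, j} := by
    intro i hi j hj
    ext m
    simp only [mem_filter, mem_range, mem_insert, mem_singleton]
    constructor
    · exact fun h => hG3 i hi j hj m h.1 h.2
    · rintro (rfl | rfl)
      · exact ⟨hi, hG1 _ _⟩
      · exact ⟨hj, hG2 _ _⟩
  have hA2 : ∀ l, ((range k).filter (fun i => I (a i) l)).card ≤ 2 := by
    intro l
    by_contra hcon
    push Not at hcon
    obtain ⟨i, hi, j, hj, hij⟩ := one_lt_card.mp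
      (show 1 < ((range k).filter (fun i => I (a i) l)).card by omega)
    simp only [mem_filter, mem_range] at hi hj
    have := hGeq i hi.1 j hj.1 hij l hi.2 hj.2
    rw [this, hGf i hi.1 j hj.1, card_pair hij] at hcon
    omega
  refine ⟨(range k).image a ∪ M.image b, ?_, ?_, ?_, ?_⟩
  · rw [hcard _ subset_rfl, card_range, add_comm]
  · rw [hline, filter_false_of_mem (fun i _ => ha0 i), filter_true_of_mem (fun o _ => hb0 o)]
    simp
  · intro l hl
    rw [hline]
    have := hM1 l hl
    have := hA2 l
    omega
  · symm
    apply card_bij (fun p _ => G p.1 p.2)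
    · rintro ⟨i, j⟩ hp
      simp only [mem_filter, mem_ltPairs] at hp
      simp only [mem_filter, mem_univ, true_and]
      refine ⟨fun h => ha0 i (h ▸ hG1 i j), ?_⟩
      rw [hline, hGf i (by omega) j (by omega), card_pair (by omega)]
      have : M.filter (fun o => I (b o) (G i j)) = {d i j} := by
        ext o
        simp only [mem_filter, hG4, mem_singleton]
        constructor
        · exact fun h => h.2
        · rintro rfl
          exact ⟨hp.2, rfl⟩
      rw [this, card_singleton]
    · rintro ⟨i, j⟩ hp ⟨i', j'⟩ hp' h
      simp only [mem_filter, mem_ltPairs] at hp hp' h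
      have h1 := hG3 i (by omega) j (by omega) i' (by omega) (h ▸ hG1 i' j')
      have h2 := hG3 i (by omega) j (by omega) j' (by omega) (h ▸ hG2 i' j')
      ext <;> simp <;> omega
    · intro l hl
      simp only [mem_filter, mem_univ, true_and] at hl
      obtain ⟨hl0, h3⟩ := hl
      rw [hline] at h3
      have h1 := hM1 l hl0
      have h2 := hA2 l
      obtain ⟨i, hi, j, hj, hij⟩ := one_lt_card.mp
        (show 1 < ((range k).filter (fun i => I (a i) l)).card by omega)
      simp only [mem_filter, mem_range] at hi hj
      obtain ⟨o, ho⟩ := card_pos.mp (show 0 < (M.filter (fun o => I (b o) l)).card by omega)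
      rw [mem_filter] at ho
      have fin : ∀ i < k, ∀ j < k, i < j → I (a i) l → I (a j) l →
          ∃ p, ∃ (_ : p ∈ (ltPairs k).filter (fun p => d p.1 p.2 ∈ M)), G p.1 p.2 = l := by
        intro i hi j hj hij hil hjl
        have hl := hGeq i hi j hj hij.ne l hil hjl
        refine ⟨(i, j), ?_, hl.symm⟩
        simp only [mem_filter, mem_ltPairs]
        refine ⟨⟨hij, hj⟩, ?_⟩
        rw [← (hG4 i j o).mp (hl ▸ ho.2)]
        exact ho.1
      rcases lt_or_gt_of_ne hij with h | h
      · exact fin i hi.1 j hj.1 h hi.2 hj.2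
      · exact fin j hj.1 i hi.1 h hj.2 hi.2

lemma incid_iff {F : Type*} [Field F] (p l : PG F) : Incid p l ↔ p.orthogonal l := by
  conv_rhs => rw [← p.mk_rep, ← l.mk_rep]
  rw [Projectivization.orthogonal_mk]
  rfl

lemma incid_mk {F : Type*} [Field F] (v w : Fin 3 → F) (hv : v ≠ 0) (hw : w ≠ 0) :
    Incid (Projectivization.mk F v hv) (Projectivization.mk F w hw) ↔
      v 0 * w 0 + v 1 * w 1 + v 2 * w 2 = 0 := by
  rw [incid_iff, Projectivization.orthogonal_mk]
  simp [dotProduct, Fin.sum_univ_three]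

open Classical in
lemma geom_PG {F : Type*} [Field F] [Fintype F] [Fintype (PG F)] (k : ℕ) (x : ℕ → F)
    (hx0 : ∀ i, x i ≠ 0)
    (hinj : ∀ i < k, ∀ j < k, x i = x j → i = j) (M : Finset (Option F)) :
    ∃ (l₀ : PG F) (S : Finset (PG F)), S.card = M.card + k ∧
      (S.filter (fun p => Incid p l₀)).card = M.card ∧
      (∀ l, l ≠ l₀ → (S.filter (fun p => Incid p l)).card ≤ 3) ∧
      (univ.filter (fun l => l ≠ l₀ ∧ (S.filter (fun p => Incid p l)).card = 3)).card =
        ((ltPairs k).filter (fun p => some (x p.1 * x p.2) ∈ M)).card := by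
  let bv : Option F → Fin 3 → F := fun o => o.elim ![1, 0, 0] (fun m => ![m, -1, 0])
  have hbv : ∀ o, bv o ≠ 0 := by
    rintro (_ | m) h
    · have := congrFun h 0
      simp [bv] at this
    · have := congrFun h 1
      simp [bv] at this
  have hav : ∀ i, ![x i, (x i)⁻¹, 1] ≠ 0 := by
    intro i h
    have := congrFun h 2
    simp at this
  have hgv : ∀ i j, ![1, x i * x j, -(x i + x j)] ≠ 0 := by
    intro i j h
    have := congrFun h 0
    simp at this
  have hl0 : (![0, 0, 1] : Fin 3 → F) ≠ 0 := by
    intro h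
    have := congrFun h 2
    simp at this
  refine ⟨Projectivization.mk F ![0, 0, 1] hl0, geom_count Incid ?_ k
    (fun i => Projectivization.mk F ![x i, (x i)⁻¹, 1] (hav i))
    (fun o => Projectivization.mk F (bv o) (hbv o)) M _
    (fun i j => Projectivization.mk F ![1, x i * x j, -(x i + x j)] (hgv i j))
    (fun i j => some (x i * x j)) ?_ ?_ ?_ ?_ ?_ ?_ ?_ ?_⟩
  · intro p p' l l' h1 h2 h3 h4
    rw [incid_iff] at h1 h2 h3 h4
    exact Configuration.ofField.eq_or_eq_of_orthogonal h1 h2 h3 h4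
  · rintro (_ | m) <;> rw [incid_mk] <;> simp [bv]
  · intro i
    rw [incid_mk]
    simp
  · intro o o' h
    rw [Projectivization.mk_eq_mk_iff'] at h
    obtain ⟨c, hc⟩ := h
    have h0 := congrFun hc 0
    have h1 := congrFun hc 1
    rcases o with _ | m <;> rcases o' with _ | m' <;> simp [bv] at h0 h1 ⊢
    · simp [h1] at h0
    · simpa [h1] using h0.symm
  · intro i hi j hj h
    rw [Projectivization.mk_eq_mk_iff'] at h
    obtain ⟨c, hc⟩ := h
    have h0 := congrFun hc 0
    have h2 := congrFun hc 2
    simp at h0 h2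
    rw [h2, one_mul] at h0
    exact hinj i hi j hj h0.symm
  · intro i j
    rw [incid_mk]
    have := hx0 i
    simp
    field_simp
    ring
  · intro i j
    rw [incid_mk]
    have := hx0 j
    simp
    field_simp
    ring
  · intro i hi j hj m hm h
    rw [incid_mk] at h
    have := hx0 m
    simp at h
    field_simp at h
    have h' : (x m - x i) * (x m - x j) = 0 := by linear_combination h
    rcases mul_eq_zero.mp h' with h | h
    · exact Or.inl (hinj m hm i hi (sub_eq_zero.mp h))
    · exact Or.inr (hinj m hm j hj (sub_eq_zero.mp h))
  · rintro i j (_ | m) <;> rw [incid_mk] <;> simp [bv]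
    rw [← sub_eq_add_neg, sub_eq_zero]

end Geom
section Match
open Finset

/-- Counting pairs in a linear space. -/
lemma linear_space_count {V ι : Type*} [DecidableEq V] [Fintype ι] (S : Finset V)
    (B : ι → Finset V) (hB : ∀ i, B i ⊆ S)
    (hcov : ∀ x ∈ S, ∀ y ∈ S, x ≠ y → ∃ i, x ∈ B i ∧ y ∈ B i)
    (huniq : ∀ x y, x ≠ y → ∀ i j, x ∈ B i → y ∈ B i → x ∈ B j → y ∈ B j → i = j) :
    ∑ i, (B i).card.choose 2 = S.card.choose 2 := by
  classical
  rw [← card_powersetCard]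
  have : powersetCard 2 S = univ.biUnion (fun i => powersetCard 2 (B i)) := by
    ext e
    simp only [mem_biUnion, mem_univ, true_and, mem_powersetCard]
    constructor
    · rintro ⟨he, hc⟩
      obtain ⟨x, y, hxy, rfl⟩ := card_eq_two.mp hc
      obtain ⟨i, hi⟩ := hcov x (he (by simp)) y (he (by simp)) hxy
      refine ⟨i, ?_, hc⟩
      intro z hz
      simp only [mem_insert, mem_singleton] at hz
      rcases hz with rfl | rfl
      · exact hi.1
      · exact hi.2
    · rintro ⟨i, hi, hc⟩
      exact ⟨hi.trans (hB i), hc⟩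
  rw [this, card_biUnion]
  · simp
  · intro i _ j _ hij
    refine disjoint_left.mpr ?_
    intro e he he'
    rw [mem_powersetCard] at he he'
    obtain ⟨x, y, hxy, rfl⟩ := card_eq_two.mp he.2
    exact hij (huniq x y hxy i j (he.1 (by simp)) (he.1 (by simp)) (he'.1 (by simp))
      (he'.1 (by simp)))

lemma equiv_of_fibers {ι κ : Type*} [Fintype ι] [Fintype κ] (f : ι → ℕ) (g : κ → ℕ)
    (h : ∀ n, (univ.filter (fun i => f i = n)).card = (univ.filter (fun i => g i = n)).card) :
    ∃ e : ι ≃ κ, ∀ i, g (e i) = f i := by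
  classical
  have h' : ∀ n, Nonempty ({i // f i = n} ≃ {i // g i = n}) := by
    intro n
    refine ⟨Fintype.equivOfCardEq ?_⟩
    rw [Fintype.card_subtype, Fintype.card_subtype, h n]
  let E := fun n => (h' n).some
  refine ⟨(Equiv.sigmaFiberEquiv f).symm.trans ((Equiv.sigmaCongrRight E).trans
    (Equiv.sigmaFiberEquiv g)), ?_⟩
  intro i
  exact (E (f i) ⟨i, rfl⟩).2

lemma natCard_of_filter {ι : Type*} [Fintype ι] (P : ι → Prop) [DecidablePred P] {t : ℕ}
    (h : (univ.filter P).card = t) : Nat.card {i // P i} = t := by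
  rw [Nat.card_eq_fintype_card, Fintype.card_subtype, h]

lemma fiber_count {ι : Type*} [Fintype ι] [DecidableEq ι] (f : ι → ℕ) (i₀ : ι)
    (h : ∀ i, i ≠ i₀ → f i = 2 ∨ f i = 3) (t N : ℕ)
    (ht : Nat.card {i // i ≠ i₀ ∧ f i = 3} = t)
    (hN : ∑ i, (f i).choose 2 = N) (n : ℕ) :
    (univ.filter (fun i => f i = n)).card = (if f i₀ = n then 1 else 0) +
      (if n = 3 then t else 0) + (if n = 2 then N - (f i₀).choose 2 - 3 * t else 0) := by
  rw [Nat.card_eq_fintype_card, Fintype.card_subtype] at ht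
  have hsplit : ∀ n, (univ.filter (fun i => f i = n)).card = (if f i₀ = n then 1 else 0) +
      (univ.filter (fun i => i ≠ i₀ ∧ f i = n)).card := by
    intro n
    have h1 : univ.filter (fun i => i ≠ i₀ ∧ f i = n) = (univ.filter (fun i => f i = n)).erase i₀ := by
      ext i; simp
    rw [h1]
    split_ifs with hh
    · rw [card_erase_of_mem (by simpa using hh)]
      have : 0 < (univ.filter (fun i => f i = n)).card := card_pos.mpr ⟨i₀, by simpa using hh⟩
      omega
    · rw [erase_eq_of_notMem (by simpa using hh)]
      omega
  have h2 : (univ.filter (fun i => i ≠ i₀ ∧ f i = 2)).card = N - (f i₀).choose 2 - 3 * t := by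
    rw [← add_sum_erase univ _ (mem_univ i₀)] at hN
    have : ∀ i ∈ univ.erase i₀, (f i).choose 2 = (if f i = 2 then 1 else 0) +
        3 * (if f i = 3 then 1 else 0) := by
      intro i hi
      rcases h i (ne_of_mem_erase hi) with h | h <;> simp [h]
    rw [sum_congr rfl this, sum_add_distrib, ← mul_sum, sum_boole, sum_boole] at hN
    have e : ∀ m, (univ.erase i₀).filter (fun i => f i = m) =
        univ.filter (fun i => i ≠ i₀ ∧ f i = m) := by
      intro m; ext i; simp
    rw [e, e, ht] at hN
    simp only [Nat.cast_id] at hN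
    omega
  rw [hsplit]
  by_cases h3 : n = 3
  · subst h3; simp only [ht]; simp
  by_cases h2' : n = 2
  · subst h2'; simp only [h2]; simp
  have : univ.filter (fun i => i ≠ i₀ ∧ f i = n) = ∅ := by
    apply filter_false_of_mem
    rintro i _ ⟨hi, hn⟩
    rcases h i hi with h | h <;> omega
  simp [this, h3, h2']

lemma match_up {ι κ : Type*} [Fintype ι] [Fintype κ] (f : ι → ℕ) (g : κ → ℕ) (i₀ : ι) (j₀ : κ)
    (hf : ∀ i, i ≠ i₀ → f i = 2 ∨ f i = 3) (hg : ∀ i, i ≠ j₀ → g i = 2 ∨ g i = 3)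
    (h0 : f i₀ = g j₀) (t N : ℕ) (ht : Nat.card {i // i ≠ i₀ ∧ f i = 3} = t)
    (ht' : Nat.card {i // i ≠ j₀ ∧ g i = 3} = t)
    (hN : ∑ i, (f i).choose 2 = N) (hN' : ∑ i, (g i).choose 2 = N) :
    ∃ e : ι ≃ κ, ∀ i, g (e i) = f i := by
  classical
  apply equiv_of_fibers
  intro n
  rw [fiber_count f i₀ hf t N ht hN, fiber_count g j₀ hg t N ht' hN', h0]

end Match
/-- A simple edge-decomposition of `K_r`, `0 ≤ r ≤ q + 1`, whose maximal
clique order `r₁` satisfies `r₁ ≥ max{(2r − 3)/3, (2r − 3) − (q + 1)}`, can be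
realized by a set `S` of `r` points of `PG(2,q)`: the multiset of intersection
sizes `|ℓ ∩ S| ≥ 2` (over lines `ℓ`) equals the multiset of clique orders,
which we express by a size-preserving bijection between the cliques and the
lines meeting `S` in at least two points. -/
theorem stmt12 {F : Type*} [Field F] [Fintype F] (q : ℕ)
    (hcard : Fintype.card F = q) (hq : Odd q)
    (r r₁ : ℕ) (hr : r ≤ q + 1)
    (D : CliqueDecomp r) (hsimple : D.Simple)
    (hmax : ∀ c ∈ D.cliques, c.card ≤ r₁)
    (hattain : ∃ c ∈ D.cliques, c.card = r₁)
    (h1 : 2 * (r : ℤ) - 3 ≤ 3 * (r₁ : ℤ))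
    (h2 : 2 * (r : ℤ) - 3 - ((q : ℤ) + 1) ≤ (r₁ : ℤ)) :
    ∃ S : Set (PG F), S.ncard = r ∧
      ∃ e : {c // c ∈ D.cliques} ≃ {l : PG F | 2 ≤ {p ∈ S | Incid p l}.ncard},
        ∀ c : {c // c ∈ D.cliques},
          {p ∈ S | Incid p (e c : PG F)}.ncard = (c : Finset (Fin r)).card := by
  classical
  let _ : Fintype (PG F) := Fintype.ofFinite _
  obtain ⟨c₀, hc₀, hc₀r⟩ := hattain
  have hr₁ : r₁ ≤ r := by
    have := Finset.card_le_univ c₀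
    simpa [hc₀r] using this
  have hq3 : 3 ≤ q := by
    have := Fintype.one_lt_card (α := F)
    obtain ⟨m, hm⟩ := hq
    omega
  have h2r₁ : 2 ≤ r₁ := hc₀r ▸ D.two_le c₀ hc₀
  -- uniqueness of the clique through two vertices
  have huniq : ∀ x y : Fin r, x ≠ y → ∀ c ∈ D.cliques, ∀ c' ∈ D.cliques,
      x ∈ c → y ∈ c → x ∈ c' → y ∈ c' → c = c' := by
    intro x y hxy c hc c' hc' h1 h2 h3 h4
    exact (D.covers x y hxy).unique ⟨hc, h1, h2⟩ ⟨hc', h3, h4⟩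
  have hsmall : ∀ c ∈ D.cliques, c ≠ c₀ → c.card = 2 ∨ c.card = 3 := by
    intro c hc hne
    have h2 := D.two_le c hc
    have hle := hmax c hc
    by_contra hcon
    have h4 : 3 < c.card := by omega
    refine hne (Finset.card_le_one.mp hsimple c ?_ c₀ ?_)
    · simp [hc, h4]
    · simp only [Finset.mem_filter]
      exact ⟨hc₀, by omega⟩
  let ι := {c // c ∈ D.cliques}
  let i₀ : ι := ⟨c₀, hc₀⟩
  obtain ⟨t, ht⟩ : ∃ t, (Finset.univ.filter
      (fun i : ι => i ≠ i₀ ∧ (i : Finset (Fin r)).card = 3)).card = t := ⟨_, rfl⟩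
  have htk : t ≤ (r - r₁).choose 2 := by
    have hpair : ∀ i : ι, ∃ e : Finset (Fin r), i ≠ i₀ ∧ (i : Finset (Fin r)).card = 3 →
        e ⊆ (i : Finset (Fin r)) \ c₀ ∧ e.card = 2 := by
      intro i
      by_cases h : i ≠ i₀ ∧ (i : Finset (Fin r)).card = 3
      · have hcap : ((i : Finset (Fin r)) ∩ c₀).card ≤ 1 := by
          rw [Finset.card_le_one]
          intro x hx y hy
          rw [Finset.mem_inter] at hx hy
          by_contra hxy
          exact h.1 (Subtype.ext (huniq x y hxy _ i.2 _ hc₀ hx.1 hy.1 hx.2 hy.2))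
        have := Finset.card_sdiff_add_card_inter (i : Finset (Fin r)) c₀
        obtain ⟨e, he, hec⟩ := Finset.exists_subset_card_eq
          (s := (i : Finset (Fin r)) \ c₀) (n := 2) (by omega)
        exact ⟨e, fun _ => ⟨he, hec⟩⟩
      · exact ⟨∅, fun h' => absurd h' h⟩
    choose e he using hpair
    have hk : (Finset.univ \ c₀).card = r - r₁ := by
      rw [Finset.card_sdiff_of_subset (Finset.subset_univ _), hc₀r, Finset.card_univ,
        Fintype.card_fin]
    rw [← ht, ← hk, ← Finset.card_powersetCard]
    apply Finset.card_le_card_of_injOn e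
    · intro i hi
      have hi' := he i (by simpa using hi)
      refine Finset.mem_coe.mpr (Finset.mem_powersetCard.mpr ?_)
      exact ⟨hi'.1.trans (Finset.sdiff_subset_sdiff (Finset.subset_univ _) subset_rfl), hi'.2⟩
    · intro i hi j hj hij
      have hi' := he i (by simpa using hi)
      have hj' := he j (by simpa using hj)
      obtain ⟨x, y, hxy, hexy⟩ := Finset.card_eq_two.mp hi'.2
      have hx : x ∈ e i := by simp [hexy]
      have hy : y ∈ e i := by simp [hexy]
      exact Subtype.ext (huniq x y hxy _ i.2 _ j.2
        (Finset.mem_sdiff.mp (hi'.1 hx)).1 (Finset.mem_sdiff.mp (hi'.1 hy)).1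
        (Finset.mem_sdiff.mp (hj'.1 (hij ▸ hx))).1 (Finset.mem_sdiff.mp (hj'.1 (hij ▸ hy))).1)
  obtain ⟨x, hx0, hxinj, M, hM, hMt⟩ := exists_M (F := F) (r - r₁) r₁ t (by omega) (by omega)
    (by omega) (by omega) (hcard ▸ hq) htk
  obtain ⟨l₀, S, hS, hl₀, hl3, hlt⟩ := geom_PG (r - r₁) x hx0 hxinj M
  rw [hM] at hS hl₀
  rw [hMt] at hlt
  have hSr : S.card = r := by omega
  have hn : ∀ l : PG F, {p ∈ (S : Set (PG F)) | Incid p l}.ncard =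
      (S.filter (fun p => Incid p l)).card := by
    intro l
    rw [← Set.ncard_coe_finset, Finset.coe_filter]
    rfl
  refine ⟨(S : Set (PG F)), by rw [Set.ncard_coe_finset, hSr], ?_⟩
  let κ := {l : PG F | 2 ≤ {p ∈ (S : Set (PG F)) | Incid p l}.ncard}
  let j₀ : κ := ⟨l₀, by show 2 ≤ _; rw [hn, hl₀]; exact h2r₁⟩
  have hκ : ∀ j : κ, 2 ≤ (S.filter (fun p => Incid p j)).card := fun j => by
    rw [← hn]; exact j.2
  -- counting pairs on both sides
  have hN : ∑ i : ι, (i : Finset (Fin r)).card.choose 2 = r.choose 2 := by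
    have := linear_space_count (ι := ι) Finset.univ (fun i => (i : Finset (Fin r)))
      (fun i => Finset.subset_univ _) (by
        intro x _ y _ hxy
        obtain ⟨c, ⟨hc, h⟩, _⟩ := D.covers x y hxy
        exact ⟨⟨c, hc⟩, h⟩) (by
        intro x y hxy i j h1 h2 h3 h4
        exact Subtype.ext (huniq x y hxy _ i.2 _ j.2 h1 h2 h3 h4))
    simpa using this
  have hN' : ∑ j : κ, (S.filter (fun p => Incid p j)).card.choose 2 = r.choose 2 := by
    rw [linear_space_count (ι := κ) S (fun j => S.filter (fun p => Incid p j))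
      (fun j => Finset.filter_subset _ _) ?_ ?_, hSr]
    · intro x hx y hy hxy
      have h1 : Incid x (Projectivization.cross x y) :=
        (incid_iff _ _).mpr (Projectivization.orthogonal_cross_left hxy)
      have h2 : Incid y (Projectivization.cross x y) :=
        (incid_iff _ _).mpr (Projectivization.orthogonal_cross_right hxy)
      refine ⟨⟨Projectivization.cross x y, ?_⟩, ?_, ?_⟩
      · show 2 ≤ _
        rw [hn]
        exact Finset.one_lt_card.mpr ⟨x, by simp [hx, h1], y, by simp [hy, h2], hxy⟩
      · simp [hx, h1]
      · simp [hy, h2]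
    · intro x y hxy i j h1 h2 h3 h4
      simp only [Finset.mem_filter, incid_iff] at h1 h2 h3 h4
      rcases Configuration.ofField.eq_or_eq_of_orthogonal h1.2 h2.2 h3.2 h4.2 with h | h
      · exact absurd h hxy
      · exact Subtype.ext h
  have ht' : (Finset.univ.filter
      (fun j : κ => j ≠ j₀ ∧ (S.filter (fun p => Incid p j)).card = 3)).card = t := by
    rw [← hlt]
    apply Finset.card_bij (fun (j : κ) _ => (j : PG F))
    · intro j hj
      simp only [Finset.mem_filter, Finset.mem_univ, true_and] at hj ⊢
      exact ⟨fun h => hj.1 (Subtype.ext h), hj.2⟩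
    · intro j _ j' _ h
      exact Subtype.ext h
    · intro l hl
      simp only [Finset.mem_filter, Finset.mem_univ, true_and] at hl
      refine ⟨⟨l, ?_⟩, ?_, rfl⟩
      · show 2 ≤ _
        rw [hn, hl.2]
        omega
      · simp only [Finset.mem_filter, Finset.mem_univ, true_and]
        exact ⟨fun h => hl.1 (congrArg Subtype.val h), hl.2⟩
  have hf : ∀ i : ι, i ≠ i₀ → (i : Finset (Fin r)).card = 2 ∨ (i : Finset (Fin r)).card = 3 :=
    fun i hi => hsmall i i.2 (fun h => hi (Subtype.ext h))
  obtain ⟨g, hg⟩ : ∃ g : κ → ℕ, ∀ j, g j = (S.filter (fun p => Incid p j)).card :=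
    ⟨_, fun _ => rfl⟩
  have hg23 : ∀ j : κ, j ≠ j₀ → g j = 2 ∨ g j = 3 := by
    intro j hj
    have h3 := hl3 j (fun h => hj (Subtype.ext h))
    have h2 := hκ j
    rw [← hg] at h3 h2
    omega
  have hg0 : g j₀ = r₁ := (hg j₀).trans hl₀
  simp only [← hg] at ht' hN'
  obtain ⟨e, he⟩ := match_up (fun i : ι => (i : Finset (Fin r)).card) g i₀ j₀ hf hg23
    (hc₀r.trans hg0.symm) t _ (natCard_of_filter _ ht) (natCard_of_filter _ ht') hN hN'
  refine ⟨e, fun c => ?_⟩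
  rw [hn, ← hg]
  exact he c
end

section
/- For all integers k and j with 0 ≤ k ≤ (q − 1)/2, k even, and 0 ≤ j ≤ q + 1, f(kq + j) ≤ k + j(q + 2 − j). -/
open scoped BigOperators

namespace Aux15

open Projectivization

variable {F : Type*} [Field F]

lemma incid_mk (p : PG F) (v : Fin 3 → F) (hv : v ≠ 0) :
    Incid p (Projectivization.mk F v hv) ↔ p.rep 0 * v 0 + p.rep 1 * v 1 + p.rep 2 * v 2 = 0 := by
  obtain ⟨a, ha⟩ := Projectivization.exists_smul_eq_mk_rep F v hv
  unfold Incid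
  rw [← ha, Fin.sum_univ_three]
  have h0 : (a : F) ≠ 0 := a.ne_zero
  simp only [Pi.smul_apply, Units.smul_def, smul_eq_mul]
  constructor
  · intro h
    apply mul_left_cancel₀ h0
    linear_combination h
  · intro h
    linear_combination (a : F) * h

lemma eq_mk_of (p : PG F) (w : Fin 3 → F) (hw : w ≠ 0) (c : F)
    (h0 : p.rep 0 = c * w 0) (h1 : p.rep 1 = c * w 1) (h2 : p.rep 2 = c * w 2) :
    p = Projectivization.mk F w hw := by
  rw [← p.mk_rep, Projectivization.mk_eq_mk_iff']
  refine ⟨c, ?_⟩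
  ext i
  fin_cases i <;> simp [h0, h1, h2]

lemma rep_ne (p : PG F) : ¬ (p.rep 0 = 0 ∧ p.rep 1 = 0 ∧ p.rep 2 = 0) := by
  rintro ⟨h0, h1, h2⟩
  apply p.rep_nonzero
  ext i
  fin_cases i <;> simp [h0, h1, h2]

lemma ne0 {a b c : F} (h : a ≠ 0 ∨ b ≠ 0 ∨ c ≠ 0) : (![a, b, c] : Fin 3 → F) ≠ 0 := by
  intro e
  have e0 := congrFun e 0
  have e1 := congrFun e 1
  have e2 := congrFun e 2
  simp at e0 e1 e2
  tauto

/-- dual conic -/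
def L : Option F → PG F
  | none => Projectivization.mk F ![0, 0, 1] (ne0 (by simp))
  | some t => Projectivization.mk F ![1, t, t ^ 2] (ne0 (by simp))

/-- lines through the interior points -/
def M (x : F × F) : PG F := Projectivization.mk F ![1, x.1, x.2] (ne0 (by simp))

/-- the point `(-n, 0, 1)` -/
def N (n : F) : PG F := Projectivization.mk F ![-n, 0, 1] (ne0 (by simp))

/-- common point of two lines of the dual conic -/
def Q : Option F × Option F → PG F
  | (none, none) => Projectivization.mk F ![1, 0, 0] (ne0 (by simp))
  | (some t, none) => Projectivization.mk F ![-t, 1, 0] (ne0 (by simp))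
  | (none, some t) => Projectivization.mk F ![-t, 1, 0] (ne0 (by simp))
  | (some t, some s) => Projectivization.mk F ![t * s, -(t + s), 1] (ne0 (by simp))

lemma M_inj : Function.Injective (M (F := F)) := by
  rintro ⟨a, b⟩ ⟨c, d⟩ h
  simp only [M, Projectivization.mk_eq_mk_iff'] at h
  obtain ⟨u, hu⟩ := h
  have e0 := congrFun hu 0
  have e1 := congrFun hu 1
  have e2 := congrFun hu 2
  simp at e0 e1 e2
  subst e0
  simp_all

lemma L_inj : Function.Injective (L (F := F)) := by
  rintro (_ | a) (_ | c) h
  · rfl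
  all_goals
    simp only [L, Projectivization.mk_eq_mk_iff'] at h
    obtain ⟨u, hu⟩ := h
    have e0 := congrFun hu 0
    have e1 := congrFun hu 1
    have e2 := congrFun hu 2
    simp at e0 e1 e2
    try (subst e0; simp_all)

lemma M_ne_L (b n : F) (hn : ¬ IsSquare n) (o : Option F) : M (b, n) ≠ L o := by
  intro h
  rcases o with (_ | t)
  all_goals
    simp only [L, M, Projectivization.mk_eq_mk_iff'] at h
    obtain ⟨u, hu⟩ := h
    have e0 := congrFun hu 0
    have e1 := congrFun hu 1
    have e2 := congrFun hu 2
    simp at e0 e1 e2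
  subst e0
  exact hn ⟨t, by rw [← e2]; ring⟩

lemma inc_M (p : PG F) (x : F × F) :
    Incid p (M x) ↔ p.rep 0 + p.rep 1 * x.1 + p.rep 2 * x.2 = 0 := by
  simp [M, incid_mk]

lemma inc_none (p : PG F) : Incid p (L none) ↔ p.rep 2 = 0 := by
  simp [L, incid_mk]

lemma inc_some (p : PG F) (t : F) :
    Incid p (L (some t)) ↔ p.rep 0 + p.rep 1 * t + p.rep 2 * t ^ 2 = 0 := by
  simp [L, incid_mk]

/-- If a point lies on the line `t`, it is `Q (t,s)` for some `s`, and is on exactly `t`, `s`. -/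
lemma exists_Q (p : PG F) (t : Option F) (h : Incid p (L t)) :
    ∃ s, p = Q (t, s) ∧ ∀ u, Incid p (L u) ↔ u = t ∨ u = s := by
  have hne := rep_ne p
  rcases t with (_ | t)
  · rw [inc_none] at h
    by_cases h1 : p.rep 1 = 0
    · refine ⟨none, eq_mk_of p _ _ (p.rep 0) (by simp) (by simp [h1]) (by simp [h]), ?_⟩
      rintro (_ | u)
      · simp [inc_none, h]
      · simp only [inc_some, h, h1]
        simp
        tauto
    · refine ⟨some (-(p.rep 0 / p.rep 1)), eq_mk_of p _ _ (p.rep 1) ?_ (by simp) (by simp [h]), ?_⟩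
      · simp; field_simp
      rintro (_ | u)
      · simp [inc_none, h]
      · simp only [inc_some, h]
        simp
        constructor
        · intro e
          field_simp
          linear_combination e
        · rintro rfl
          field_simp
          ring
  · rw [inc_some] at h
    by_cases h2 : p.rep 2 = 0
    · have h1 : p.rep 1 ≠ 0 := by
        intro h1
        simp [h1, h2] at h
        tauto
      refine ⟨none, eq_mk_of p _ _ (p.rep 1) ?_ (by simp) (by simp [h2]), ?_⟩
      · simp
        rw [h2] at h
        linear_combination h
      rintro (_ | u)
      · simp [inc_none, h2]
      · simp only [inc_some, h2]
        rw [h2] at h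
        simp
        constructor
        · intro e
          apply mul_left_cancel₀ h1
          linear_combination e - h
        · rintro rfl
          linear_combination h
    · have hs : ∃ s, p.rep 1 = p.rep 2 * (-(t + s)) := by
        refine ⟨-(p.rep 1 / p.rep 2) - t, ?_⟩
        field_simp
        ring
      obtain ⟨s, hs⟩ := hs
      have h0 : p.rep 0 = p.rep 2 * (t * s) := by
        rw [hs] at h
        linear_combination h
      refine ⟨some s, eq_mk_of p _ _ (p.rep 2) (by simp [h0]) (by simp [hs]) (by simp), ?_⟩
      rintro (_ | u)
      · simp [inc_none, h2]
      · simp only [inc_some]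
        have e : p.rep 0 + p.rep 1 * u + p.rep 2 * u ^ 2 = p.rep 2 * ((u - t) * (u - s)) := by
          rw [h0, hs]; ring
        rw [e]
        simp [h2, sub_eq_zero]

lemma Podd_conic [Fintype F] [DecidableEq F] (J : Finset (Option F)) (p : PG F)
    (hp : Odd {u ∈ (J : Set (Option F)) | Incid p (L u)}.ncard) :
    p ∈ Q '' (((J ×ˢ Jᶜ) ∪ J.image (fun t => (t, t)) : Finset (Option F × Option F)) :
      Set (Option F × Option F)) := by
  have hne : {u ∈ (J : Set (Option F)) | Incid p (L u)}.Nonempty := by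
    by_contra hcon
    rw [Set.not_nonempty_iff_eq_empty] at hcon
    rw [hcon] at hp
    simp at hp
  obtain ⟨t, htJ, ht⟩ := hne
  obtain ⟨s, hs, hall⟩ := exists_Q p t ht
  refine ⟨(t, s), ?_, hs.symm⟩
  have htJ' : t ∈ J := htJ
  by_cases hts : t = s
  · subst hts
    simp [htJ']
  by_cases hsJ : s ∈ J
  · exfalso
    have : {u ∈ (J : Set (Option F)) | Incid p (L u)} = {t, s} := by
      ext u
      simp only [Set.mem_ofPred_eq, hall, Set.mem_insert_iff, Set.mem_singleton_iff]
      constructor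
      · exact fun h => h.2
      · rintro (rfl | rfl)
        · exact ⟨htJ, Or.inl rfl⟩
        · exact ⟨hsJ, Or.inr rfl⟩
    rw [this, Set.ncard_pair hts] at hp
    exact absurd hp (by decide)
  · simp [htJ', hsJ]

lemma Podd_pencil [Fintype F] (K : Finset F) (hK : Even K.card) (p : PG F)
    (hp : Odd {x ∈ ((Finset.univ ×ˢ K : Finset (F × F)) : Set (F × F)) | Incid p (M x)}.ncard) :
    p ∈ N '' (K : Set F) := by
  by_cases h1 : p.rep 1 = 0
  · have hne : {x ∈ ((Finset.univ ×ˢ K : Finset (F × F)) : Set (F × F)) |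
        Incid p (M x)}.Nonempty := by
      by_contra hcon
      rw [Set.not_nonempty_iff_eq_empty] at hcon
      rw [hcon] at hp
      simp at hp
    obtain ⟨⟨b, n⟩, hx, hi⟩ := hne
    rw [inc_M] at hi
    simp [h1] at hi
    refine ⟨n, by simpa using hx, ?_⟩
    refine (eq_mk_of p _ _ (p.rep 2) ?_ (by simp [h1]) (by simp)).symm
    simp
    linear_combination hi
  · exfalso
    have : {x ∈ ((Finset.univ ×ˢ K : Finset (F × F)) : Set (F × F)) | Incid p (M x)} =
        (fun n => (-(p.rep 0 + p.rep 2 * n) / p.rep 1, n)) '' (K : Set F) := by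
      ext ⟨b, n⟩
      simp only [Set.mem_ofPred_eq, inc_M, Set.mem_image, Finset.mem_coe, Finset.mem_product,
        Finset.mem_univ, true_and, Prod.mk.injEq]
      constructor
      · rintro ⟨hn, h⟩
        refine ⟨n, hn, ?_, rfl⟩
        field_simp
        linear_combination -h
      · rintro ⟨m, hm, h, rfl⟩
        refine ⟨hm, ?_⟩
        rw [← h]
        field_simp
        ring
    rw [this, Set.ncard_image_of_injective _ (fun a b h => (Prod.mk.inj h).2),
      Set.ncard_coe_finset] at hp
    exact (Nat.not_odd_iff_even.2 hK) hp

lemma card_nonsq [Fintype F] [DecidableEq F] (q : ℕ) (hcard : Fintype.card F = q) (hq : Odd q) :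
    ∃ S : Finset F, (∀ n ∈ S, ¬ IsSquare n) ∧ (q - 1) / 2 ≤ S.card := by
  classical
  have hchar : ringChar F ≠ 2 := by
    intro h
    have := FiniteField.even_card_iff_char_two.1 h
    rw [hcard] at this
    obtain ⟨m, rfl⟩ := hq
    omega
  refine ⟨Finset.univ.filter (fun n => ¬ IsSquare n), by simp, ?_⟩
  have hsum := quadraticChar_sum_zero hchar
  have hpt : ∀ a : F, (1 : ℤ) = quadraticChar F a + (if a = 0 then 1 else 0) +
      2 * (if ¬ IsSquare a then 1 else 0) := by
    intro a
    by_cases h0 : a = 0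
    · subst h0; simp
    by_cases hs : IsSquare a
    · simp [h0, hs, (quadraticChar_one_iff_isSquare h0).2 hs]
    · simp [h0, hs, quadraticChar_neg_one_iff_not_isSquare.2 hs]
  have htot : (∑ a : F, (1 : ℤ)) = ∑ a : F, (quadraticChar F a + (if a = 0 then 1 else 0) +
      2 * (if ¬ IsSquare a then 1 else 0)) := Finset.sum_congr rfl (fun a _ => hpt a)
  rw [Finset.sum_add_distrib, Finset.sum_add_distrib, hsum, ← Finset.mul_sum,
    Finset.sum_boole, Finset.sum_boole] at htot
  have hz : (Finset.univ.filter (fun a : F => a = 0)).card = 1 := by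
    rw [Finset.filter_eq' Finset.univ (0 : F)]
    simp
  rw [hz] at htot
  simp only [Finset.sum_const, Finset.card_univ, hcard, nsmul_eq_mul, mul_one] at htot
  omega

end Aux15

open Aux15 in
/-- `f(kq + j) ≤ k + j(q + 2 − j)` for `0 ≤ k ≤ (q − 1)/2`, `k` even, and
`0 ≤ j ≤ q + 1`. -/
theorem stmt15 {F : Type*} [Field F] [Fintype F] (q : ℕ)
    (hcard : Fintype.card F = q) (hq : Odd q)
    (k j : ℕ) (hk : k ≤ (q - 1) / 2) (hke : Even k) (hj : j ≤ q + 1) :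
    fmin F (k * q + j) ≤ k + j * (q + 2 - j) := by
  classical
  obtain ⟨S, hS, hSc⟩ := card_nonsq (F := F) q hcard hq
  obtain ⟨K, hKS, hKc⟩ := Finset.exists_subset_card_eq (hk.trans hSc)
  obtain ⟨J, -, hJc⟩ := Finset.exists_subset_card_eq (s := (Finset.univ : Finset (Option F)))
    (n := j) (by simpa [hcard] using hj)
  set A : Finset (F × F) := Finset.univ ×ˢ K with hA
  have hdisj : Disjoint (M '' (A : Set (F × F))) (L '' (J : Set (Option F))) := by
    rw [Set.disjoint_left]
    rintro _ ⟨⟨b, n⟩, hx, rfl⟩ ⟨o, -, ho⟩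
    have hn : n ∈ K := by simpa [hA] using hx
    exact M_ne_L b n (hS n (hKS hn)) o ho.symm
  have hfin : ∀ s : Set (PG F), s.Finite := fun s => Set.toFinite s
  have hR : (M '' (A : Set (F × F)) ∪ L '' (J : Set (Option F))).ncard = k * q + j := by
    rw [Set.ncard_union_eq hdisj, Set.ncard_image_of_injective _ M_inj,
      Set.ncard_image_of_injective _ L_inj, Set.ncard_coe_finset, Set.ncard_coe_finset, hJc, hA,
      Finset.card_product, Finset.card_univ, hcard, hKc, mul_comm]
  have hle : fmin F (k * q + j) ≤
      (Podd F (M '' (A : Set (F × F)) ∪ L '' (J : Set (Option F)))).ncard :=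
    Nat.sInf_le (show _ ∈ {n | ∃ R : Set (PG F), R.ncard = k * q + j ∧ (Podd F R).ncard = n} from
      ⟨_, hR, rfl⟩)
  refine hle.trans ?_
  set T : Finset (Option F × Option F) := (J ×ˢ Jᶜ) ∪ J.image (fun t => (t, t)) with hT
  have hTc : T.card ≤ j * (q + 2 - j) := by
    refine (Finset.card_union_le _ _).trans ?_
    have h1 : (J.image (fun t => (t, t))).card ≤ j := hJc ▸ Finset.card_image_le
    rw [Finset.card_product, Finset.card_compl, hJc, Fintype.card_option, hcard]
    have : q + 2 - j = (q + 1 - j) + 1 := by omega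
    rw [this, mul_add]
    omega
  have hsub : Podd F (M '' (A : Set (F × F)) ∪ L '' (J : Set (Option F))) ⊆
      N '' (K : Set F) ∪ Q '' (T : Set (Option F × Option F)) := by
    intro p hp
    have heq : {l ∈ M '' (A : Set (F × F)) ∪ L '' (J : Set (Option F)) | Incid p l} =
        M '' {x ∈ (A : Set (F × F)) | Incid p (M x)} ∪
        L '' {x ∈ (J : Set (Option F)) | Incid p (L x)} := by
      ext l
      constructor
      · rintro ⟨⟨x, hx, rfl⟩ | ⟨x, hx, rfl⟩, hi⟩
        · exact Or.inl ⟨x, ⟨hx, hi⟩, rfl⟩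
        · exact Or.inr ⟨x, ⟨hx, hi⟩, rfl⟩
      · rintro (⟨x, ⟨hx, hi⟩, rfl⟩ | ⟨x, ⟨hx, hi⟩, rfl⟩)
        · exact ⟨Or.inl ⟨x, hx, rfl⟩, hi⟩
        · exact ⟨Or.inr ⟨x, hx, rfl⟩, hi⟩
    have hp' : Odd {l ∈ M '' (A : Set (F × F)) ∪ L '' (J : Set (Option F)) | Incid p l}.ncard := hp
    rw [heq, Set.ncard_union_eq (hdisj.mono (Set.image_mono (fun x h => h.1))
      (Set.image_mono (fun x h => h.1))), Set.ncard_image_of_injective _ M_inj,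
      Set.ncard_image_of_injective _ L_inj] at hp'
    rcases Nat.even_or_odd {x ∈ (A : Set (F × F)) | Incid p (M x)}.ncard with he | ho
    · right
      exact Podd_conic J p ((Nat.odd_add'.1 hp').2 he)
    · left
      exact Podd_pencil K (hKc ▸ hke) p ho
  calc _ ≤ _ := Set.ncard_le_ncard hsub (hfin _)
    _ ≤ _ := Set.ncard_union_le _ _
    _ ≤ (K : Set F).ncard + (T : Set (Option F × Option F)).ncard :=
      add_le_add (Set.ncard_image_le (Set.toFinite _)) (Set.ncard_image_le (Set.toFinite _))
    _ ≤ _ := by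
      rw [Set.ncard_coe_finset, Set.ncard_coe_finset, hKc]
      exact Nat.add_le_add_left hTc k
end
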